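/- Let C̃ be a bisymmetric (n−1)×(n−1) real matrix, c_0, c_n ∈ ℝ, c ∈ ℝ^{n−1}, č := P c. Let k ∈ {1,…,K−1}, θ_k := cos(πk/K), p ∈ ℝ^{n−1}, and let s_k[p] be the mesh vector with node values sin(πkj/K) and element values p sin(πk(j−1)/K) + p̌ sin(πkj/K), j = 1,…,K. Then (C s_k[p], s_k[p]) = K { c_0 + (C̃ p + 2c)·p + θ_k [ c_n + (C̃ p + 2c)·p̌ ] }. -/

import Mathlib

open Matrix

/-- The reversal operator on ℝ^m. -/
def revVec (m : ℕ) (p : Fin m → ℝ) : Fin m → ℝ := fun i => p i.rev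

/-- A matrix is bisymmetric if it is symmetric w.r.t. the main and
secondary diagonals. -/
def Bisym {m : ℕ} (B : Matrix (Fin m) (Fin m) ℝ) : Prop :=
  (∀ i j, B i j = B j i) ∧ (∀ i j, B i j = B j.rev i.rev)

/-- The C-bilinear form (Cv, w) of mesh vectors. -/
def Cform (n K : ℕ) (Ct : Matrix (Fin (n-1)) (Fin (n-1)) ℝ) (c0 cn : ℝ)
    (c : Fin (n-1) → ℝ) (vN : ℕ → ℝ) (vE : ℕ → Fin (n-1) → ℝ)
    (wN : ℕ → ℝ) (wE : ℕ → Fin (n-1) → ℝ) : ℝ :=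
  (∑ j ∈ Finset.Icc 1 (K-1),
      (2 * c0 * vN j + cn * (vN (j-1) + vN (j+1))
        + revVec (n-1) c ⬝ᵥ vE j + c ⬝ᵥ vE (j+1)) * wN j)
  + ∑ j ∈ Finset.Icc 1 K,
      (vN (j-1) • c + Ct.mulVec (vE j) + vN j • revVec (n-1) c) ⬝ᵥ wE j

theorem revVec_dotProduct_revVec (m : ℕ) (u w : Fin m → ℝ) :
    revVec m u ⬝ᵥ revVec m w = u ⬝ᵥ w :=
  Equiv.sum_comp Fin.revPerm fun i => u i * w i

theorem revVec_revVec (m : ℕ) (u : Fin m → ℝ) : revVec m (revVec m u) = u := by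
  ext i
  simp [revVec]

theorem revVec_dotProduct (m : ℕ) (u w : Fin m → ℝ) :
    revVec m u ⬝ᵥ w = u ⬝ᵥ revVec m w := by
  rw [← revVec_dotProduct_revVec, revVec_revVec]

theorem Bisym.mulVec_revVec {m : ℕ} {B : Matrix (Fin m) (Fin m) ℝ} (hB : Bisym B)
    (p : Fin m → ℝ) : B.mulVec (revVec m p) = revVec m (B.mulVec p) := by
  ext i
  simp only [revVec, Matrix.mulVec, dotProduct]
  rw [← Equiv.sum_comp Fin.revPerm]
  refine Finset.sum_congr rfl fun j _ => ?_
  rw [hB.2 i.rev j, hB.1 j.rev]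
  simp

theorem sum_sin_sq_mul (x : ℝ) (N : ℕ) :
    4 * Real.sin x * ∑ j ∈ Finset.range N, Real.sin (j * x) ^ 2
      = 2 * N * Real.sin x - (Real.sin (2 * (N * x) - x) + Real.sin x) := by
  induction N with
  | zero => simp
  | succ N ih =>
    rw [Finset.sum_range_succ, mul_add, ih]
    have h : 2 * (((N + 1 : ℕ) : ℝ) * x) - x = 2 * (N * x) + x := by push_cast; ring
    rw [h, Real.sin_add, Real.sin_sub, Real.cos_two_mul, Real.cos_sq']
    push_cast
    ring

theorem sum_sin_mul_sin_succ_mul (x : ℝ) (N : ℕ) :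
    4 * Real.sin x * ∑ j ∈ Finset.range N, Real.sin (j * x) * Real.sin ((j + 1 : ℕ) * x)
      = 2 * N * Real.sin x * Real.cos x - Real.sin (2 * (N * x)) := by
  induction N with
  | zero => simp
  | succ N ih =>
    rw [Finset.sum_range_succ, mul_add, ih]
    have h : ((N + 1 : ℕ) : ℝ) * x = N * x + x := by push_cast; ring
    rw [h, Real.sin_two_mul, Real.sin_two_mul, Real.sin_add, Real.cos_add]
    push_cast
    linear_combination (2 * Real.sin x * Real.cos x) * Real.sin_sq_add_cos_sq (N * x)
      + (2 * Real.sin (N * x) * Real.cos (N * x)) * Real.sin_sq_add_cos_sq x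

theorem sin_pi_mul_div_pos {k K : ℕ} (hk : 1 ≤ k) (hkK : k < K) :
    0 < Real.sin (Real.pi * k / K) := by
  have hk' : (0 : ℝ) < k := by exact_mod_cast hk
  have hkK' : (k : ℝ) < K := by exact_mod_cast hkK
  have hK : (0 : ℝ) < K := hk'.trans hkK'
  apply Real.sin_pos_of_pos_of_lt_pi
  · have := Real.pi_pos
    positivity
  · rw [div_lt_iff₀ hK]
    exact mul_lt_mul_of_pos_left hkK' Real.pi_pos

/-- the squared C-norm of the mesh vector s_k[p]. -/
theorem sk_squared_C_norm
    (n K : ℕ) (hn : 2 ≤ n) (hK : 2 ≤ K)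
    (Ct : Matrix (Fin (n-1)) (Fin (n-1)) ℝ) (hCt : Bisym Ct)
    (c0 cn : ℝ) (c : Fin (n-1) → ℝ)
    (k : ℕ) (hk1 : 1 ≤ k) (hk2 : k ≤ K - 1)
    (p : Fin (n-1) → ℝ) :
    Cform n K Ct c0 cn c
        (fun j => Real.sin (Real.pi * k * j / K))
        (fun j => Real.sin (Real.pi * k * ((j : ℝ) - 1) / K) • p
                  + Real.sin (Real.pi * k * j / K) • revVec (n-1) p)
        (fun j => Real.sin (Real.pi * k * j / K))
        (fun j => Real.sin (Real.pi * k * ((j : ℝ) - 1) / K) • p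
                  + Real.sin (Real.pi * k * j / K) • revVec (n-1) p)
      = K * (c0 + (Ct.mulVec p + (2 : ℝ) • c) ⬝ᵥ p
            + Real.cos (Real.pi * k / K)
              * (cn + (Ct.mulVec p + (2 : ℝ) • c) ⬝ᵥ revVec (n-1) p)) := by
  have hkK : k < K := by omega
  have hK0 : (K : ℝ) ≠ 0 := Nat.cast_ne_zero.mpr (by omega)
  set x : ℝ := Real.pi * k / K with hx
  have hKx : (K : ℝ) * x = k * Real.pi := by rw [hx]; field_simp
  have hsin : Real.sin x ≠ 0 := (sin_pi_mul_div_pos hk1 hkK).ne'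
  have hsinK : Real.sin (K * x) = 0 := by rw [hKx, Real.sin_nat_mul_pi]
  have hsin2K : Real.sin (2 * (K * x)) = 0 := by rw [Real.sin_two_mul, hsinK]; ring
  have hcos2K : Real.cos (2 * (K * x)) = 1 := by
    rw [Real.cos_two_mul, Real.cos_sq', hsinK]; norm_num
  set S : ℕ → ℝ := fun j => Real.sin (j * x) with hS
  have hsq : ∑ j ∈ Finset.range K, S j ^ 2 = K / 2 := by
    have h := sum_sin_sq_mul x K
    rw [Real.sin_sub, hsin2K, hcos2K] at h
    apply mul_left_cancel₀ (mul_ne_zero four_ne_zero hsin)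
    rw [h]
    ring
  have hmul : ∑ j ∈ Finset.range K, S j * S (j + 1) = K * Real.cos x / 2 := by
    have h := sum_sin_mul_sin_succ_mul x K
    rw [hsin2K] at h
    apply mul_left_cancel₀ (mul_ne_zero four_ne_zero hsin)
    rw [h]
    ring
  have hS0 : S 0 = 0 := by simp [hS]
  have hSK : S K = 0 := hsinK
  have hsq' : ∑ j ∈ Finset.range K, S (j + 1) ^ 2 = K / 2 := by
    have h := Finset.sum_range_succ' (fun j => S j ^ 2) K
    rw [Finset.sum_range_succ, hsq, hS0, hSK] at h
    linarith
  have hrec (j : ℕ) : S j + S (j + 2) = 2 * Real.cos x * S (j + 1) := by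
    have h₁ : (j : ℝ) * x = (j + 1 : ℕ) * x - x := by push_cast; ring
    have h₂ : ((j + 2 : ℕ) : ℝ) * x = (j + 1 : ℕ) * x + x := by push_cast; ring
    simp only [hS]
    rw [h₁, h₂, Real.sin_sub, Real.sin_add]
    ring
  have hnode (j : ℕ) : Real.sin (Real.pi * k * j / K) = S j := by
    simp only [hS, hx]; congr 1; ring
  have hprev (j : ℕ) : Real.sin (Real.pi * k * (((j + 1 : ℕ) : ℝ) - 1) / K) = S j := by
    rw [← hnode]; push_cast; congr 2; ring
  have hshift (N : ℕ) (f : ℕ → ℝ) :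
      ∑ j ∈ Finset.Icc 1 N, f j = ∑ j ∈ Finset.range N, f (j + 1) := by
    rw [Finset.range_eq_Ico, Finset.sum_Ico_add']
    rfl
  have hinner : ∑ j ∈ Finset.range (K - 1), S (j + 1) ^ 2 = K / 2 := by
    have h := Finset.sum_range_succ' (fun j => S j ^ 2) (K - 1)
    rw [Nat.sub_add_cancel (by omega), hsq, hS0] at h
    linarith
  simp only [Cform, hshift, hprev, hnode, Nat.add_sub_cancel, Matrix.mulVec_add,
    Matrix.mulVec_smul, hCt.mulVec_revVec, dotProduct_add, add_dotProduct, smul_dotProduct,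
    dotProduct_smul, smul_eq_mul, revVec_dotProduct, revVec_revVec]
  set a := c ⬝ᵥ p
  set b := c ⬝ᵥ revVec (n-1) p
  set A := Ct.mulVec p ⬝ᵥ p
  set B := Ct.mulVec p ⬝ᵥ revVec (n-1) p
  trans (2 * (c0 + Real.cos x * cn + a + Real.cos x * b))
        * ∑ j ∈ Finset.range (K - 1), S (j + 1) ^ 2
      + ((a + A) * ∑ j ∈ Finset.range K, S j ^ 2
        + (a + A) * ∑ j ∈ Finset.range K, S (j + 1) ^ 2
        + 2 * (b + B) * ∑ j ∈ Finset.range K, S j * S (j + 1))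
  · simp only [Finset.mul_sum, ← Finset.sum_add_distrib]
    congr 1
    · refine Finset.sum_congr rfl fun j _ => ?_
      linear_combination (cn + b) * S (j + 1) * hrec j
    · refine Finset.sum_congr rfl fun j _ => ?_
      ring
  · rw [hinner, hsq, hsq', hmul]
    ring
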